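/- Let p ∈ ℕ (p ≥ 1) and 0 ≤ b ≤ 1. If f ∈ 𝒜_{p,b} satisfies f(z) ≠ 0 for all z ∈ 𝔻 \ {0} and Re(z f'(z)/f(z)) > p − 1/(1+b) for all z ∈ 𝔻 \ {0}, then Re(f(z)/z^p) > 1/2 for all z ∈ 𝔻 \ {0} (equivalently, the analytic extension g of f(z)/z^p satisfies Re g(z) > 1/2 on 𝔻). -/

import Mathlib

open ComplexConjugate in
lemma aux_pick (φ : ℂ → ℂ) (hd : DifferentiableOn ℂ φ (Metric.ball 0 1))
    (hm : ∀ z ∈ Metric.ball (0:ℂ) 1, ‖φ z‖ ≤ 1) (h0 : ‖φ 0‖ < 1) (z : ℂ) (hz : ‖z‖ < 1) :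
    ‖φ z‖ * (1 + ‖φ 0‖ * ‖z‖) ≤ ‖φ 0‖ + ‖z‖ := by
  have hden : ∀ w ∈ Metric.ball (0:ℂ) 1, 1 - conj (φ 0) * φ w ≠ 0 := by
    intro w hw h
    have h1 : conj (φ 0) * φ w = 1 := (sub_eq_zero.1 h).symm
    have h2 : ‖φ 0‖ * ‖φ w‖ = 1 := by
      have := congrArg norm h1
      simpa using this
    have := hm w hw
    nlinarith [norm_nonneg (φ 0), norm_nonneg (φ w)]
  have key : ∀ w : ℂ, Complex.normSq (1 - conj (φ 0) * w) - Complex.normSq (w - φ 0)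
      = (1 - Complex.normSq (φ 0)) * (1 - Complex.normSq w) := by
    intro w
    simp [Complex.normSq_apply]
    ring
  have hM : ‖(fun w => (φ w - φ 0) / (1 - conj (φ 0) * φ w)) z‖ ≤ ‖z‖ := by
    refine Complex.norm_le_norm_of_mapsTo_ball (R := 1)
      (f := fun w => (φ w - φ 0) / (1 - conj (φ 0) * φ w)) ?_ ?_ ?_ ?_
    · exact (hd.sub_const _).div ((hd.const_mul _).const_sub _) hden
    · intro w hw
      have hdw := hden w hw
      simp only [mem_closedBall_zero_iff, norm_div]
      rw [div_le_one (norm_pos_iff.2 hdw)]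
      have k := key (φ w)
      simp only [Complex.normSq_eq_norm_sq] at k
      have h1 := hm w hw
      apply le_of_sq_le_sq _ (norm_nonneg _)
      have : 0 ≤ (1 - ‖φ 0‖^2) * (1 - ‖φ w‖^2) := by
        apply mul_nonneg <;> nlinarith [norm_nonneg (φ 0), norm_nonneg (φ w)]
      linarith
    · simp
    · exact hz
  have hzb : z ∈ Metric.ball (0:ℂ) 1 := by simpa using hz
  have hdz := norm_pos_iff.2 (hden z hzb)
  simp only [norm_div] at hM
  rw [div_le_iff₀ hdz] at hM
  have k := key (φ z)
  simp only [Complex.normSq_eq_norm_sq] at k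
  have hP := hm z hzb
  have tri : ‖φ z - φ 0‖ ≥ ‖φ z‖ - ‖φ 0‖ := norm_sub_norm_le _ _
  by_contra! hc
  set P := ‖φ z‖
  set A := ‖φ 0‖
  set t := ‖z‖
  have hA : 0 ≤ A := norm_nonneg _
  have hP0 : 0 ≤ P := norm_nonneg _
  have ht : 0 ≤ t := norm_nonneg _
  have hPA : t * (1 - A * P) < P - A := by nlinarith
  have h1 : 0 ≤ 1 - A * P := by nlinarith
  have hs : ‖φ z - φ 0‖^2 ≤ t^2 * ‖1 - conj (φ 0) * φ z‖^2 := by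
    rw [← mul_pow]; exact pow_le_pow_left₀ (norm_nonneg _) hM 2
  have h2 : (t * (1 - A * P))^2 < (P - A)^2 := by
    apply pow_lt_pow_left₀ hPA (by positivity) (by norm_num)
  have h3 : (P - A)^2 ≤ ‖φ z - φ 0‖^2 := by
    apply pow_le_pow_left₀ _ tri
    nlinarith [mul_nonneg ht h1]
  have h4 : t^2 < 1 := by nlinarith
  nlinarith

lemma aux_growth (u : ℂ → ℂ) (hd : DifferentiableOn ℂ u (Metric.ball 0 1))
    (hm : ∀ z ∈ Metric.ball (0:ℂ) 1, ‖u z‖ ≤ 1) (h0 : u 0 = 0) (hA : ‖deriv u 0‖ < 1)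
    (z : ℂ) (hz : ‖z‖ < 1) :
    ‖u z‖ * (1 + ‖deriv u 0‖ * ‖z‖) ≤ ‖z‖ * (‖deriv u 0‖ + ‖z‖) := by
  have h := aux_pick (dslope u 0)
    ((Complex.differentiableOn_dslope (Metric.ball_mem_nhds _ one_pos)).2 hd)
    (fun w hw => by
      have := Complex.norm_dslope_le_div_of_mapsTo_ball (R₂ := 1) hd
        (fun x hx => by simpa [h0] using hm x hx) hw
      simpa using this) (by simpa using hA) z hz
  rw [dslope_same] at h
  have h2 : u z = z * dslope u 0 z := by
    have := sub_smul_dslope u 0 z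
    simp [h0] at this
    exact this.symm
  rw [h2, norm_mul, mul_assoc]
  exact mul_le_mul_of_nonneg_left h (norm_nonneg _)

open ComplexConjugate in
lemma aux_jack (u : ℂ → ℂ) (hd : DifferentiableOn ℂ u (Metric.ball 0 1))
    (hm : ∀ z : ℂ, ‖z‖ ≤ 1 → ‖u z‖ ≤ 1) (h0 : u 0 = 0) (hA : ‖deriv u 0‖ < 1)
    (h1 : ‖u 1‖ = 1) (u' : ℂ) (hu' : HasDerivAt u u' 1) :
    (u' * conj (u 1)).im = 0 ∧ 2 ≤ (u' * conj (u 1)).re * (1 + ‖deriv u 0‖) := by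
  have hone : u 1 * conj (u 1) = 1 := by
    rw [Complex.mul_conj, Complex.normSq_eq_norm_sq, h1]; simp
  have hre : ∀ z, (u z * conj (u 1)).re ≤ ‖u z‖ := by
    intro z
    refine (Complex.re_le_norm _).trans ?_
    simp [h1]
  constructor
  · have hE : HasDerivAt (fun θ : ℂ => Complex.exp (θ * Complex.I)) Complex.I ((0:ℝ):ℂ) := by
      have := ((hasDerivAt_id ((0:ℝ):ℂ)).mul_const Complex.I).cexp
      simpa using this
    have hc : HasDerivAt (fun θ : ℂ => u (Complex.exp (θ * Complex.I)) * conj (u 1))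
        (u' * Complex.I * conj (u 1)) ((0:ℝ):ℂ) := by
      refine HasDerivAt.mul_const ?_ _
      exact HasDerivAt.comp_of_eq _ hu' hE (by simp)
    have hr := hc.real_of_complex
    have hmax : IsLocalMax (fun θ : ℝ => (u (Complex.exp ((θ:ℂ) * Complex.I)) * conj (u 1)).re) 0 := by
      refine Filter.Eventually.of_forall fun θ => ?_
      refine (hre _).trans ?_
      refine (hm _ (by simp [Complex.norm_exp_ofReal_mul_I])).trans ?_
      simp [hone]
    have := hmax.hasDerivAt_eq_zero hr
    have e : u' * Complex.I * conj (u 1) = (u' * conj (u 1)) * Complex.I := by ring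
    rw [e, Complex.mul_I_re] at this
    linarith
  · set A := ‖deriv u 0‖ with hAdef
    have hu1 : HasDerivAt u u' ((1:ℝ):ℂ) := by simpa using hu'
    have hq := (hu1.mul_const (conj (u 1))).real_of_complex
    have hF : HasDerivAt (fun t : ℝ => t * (A + t) - (u t * conj (u 1)).re * (1 + A * t))
        (2 - (u' * conj (u 1)).re * (1 + A)) 1 := by
      have a := ((hasDerivAt_id (1:ℝ)).mul ((hasDerivAt_id (1:ℝ)).const_add A)).sub
        (hq.mul (((hasDerivAt_id (1:ℝ)).const_mul A).const_add 1))
      refine a.congr_deriv ?_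
      simp [hone]
      ring
    have hs := (hasDerivAt_iff_tendsto_slope.1 hF).mono_left
      (nhdsWithin_mono 1 (fun x (hx : x < 1) => ne_of_lt hx) : nhdsWithin (1:ℝ) (Set.Iio 1) ≤ _)
    have hle : 2 - (u' * conj (u 1)).re * (1 + A) ≤ 0 := by
      refine le_of_tendsto hs ?_
      filter_upwards [Ioo_mem_nhdsLT (zero_lt_one (α := ℝ))] with t ht
      rw [slope_def_field]
      have hg := aux_growth u hd (fun z hz => hm z (by simpa using (le_of_lt (mem_ball_zero_iff.1 hz)))) h0 hA (t:ℂ)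
        (by simpa [abs_of_pos ht.1] using ht.2)
      simp only [Complex.norm_real, Real.norm_eq_abs, abs_of_pos ht.1] at hg
      apply div_nonpos_of_nonneg_of_nonpos _ (by linarith [ht.2])
      have hA0 : 0 ≤ A := norm_nonneg _
      have := mul_le_mul_of_nonneg_right (hre t) (by nlinarith [mul_nonneg hA0 ht.1.le] : 0 ≤ 1 + A * t)
      rw [← hAdef] at hg
      simp only [Complex.ofReal_one, hone, Complex.one_re]
      linarith
    linarith

open ComplexConjugate in
theorem aux_main (b : ℝ) (hb0 : 0 ≤ b) (hb1 : b ≤ 1)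
    (g : ℂ → ℂ) (hg : DifferentiableOn ℂ g (Metric.ball 0 1)) (hg0 : g 0 = 1)
    (hgb : deriv g 0 = (b : ℂ))
    (hne : ∀ z ∈ Metric.ball (0 : ℂ) 1, g z ≠ 0)
    (hstar : ∀ z ∈ Metric.ball (0 : ℂ) 1, z ≠ 0 →
      - (1 / (1 + b)) < (z * deriv g z / g z).re) :
    ∀ z ∈ Metric.ball (0 : ℂ) 1, 1 / 2 < (g z).re := by
  set w : ℂ → ℂ := fun z => 1 - (g z)⁻¹ with hw
  have hwd : DifferentiableOn ℂ w (Metric.ball 0 1) := (hg.inv hne).const_sub _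
  have hgd : ∀ z ∈ Metric.ball (0 : ℂ) 1, HasDerivAt g (deriv g z) z := fun z hz =>
    (hg.differentiableAt (Metric.isOpen_ball.mem_nhds hz)).hasDerivAt
  have hwd' : ∀ z ∈ Metric.ball (0 : ℂ) 1, HasDerivAt w (deriv g z / (g z)^2) z := by
    intro z hz
    have := ((hgd z hz).inv (hne z hz)).const_sub 1
    refine this.congr_deriv ?_
    ring
  have hw0 : w 0 = 0 := by simp [hw, hg0]
  suffices H : ∀ z ∈ Metric.ball (0 : ℂ) 1, ‖w z‖ < 1 by
    intro z hz
    have h1 := H z hz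
    have h2 : ‖g z - 1‖ < ‖g z‖ := by
      have e : g z - 1 = g z * w z := by
        have := hne z hz
        simp only [hw]; field_simp
      rw [e, norm_mul]
      have := norm_pos_iff.2 (hne z hz)
      nlinarith
    have h3 : ‖g z - 1‖^2 < ‖g z‖^2 := pow_lt_pow_left₀ h2 (norm_nonneg _) (by norm_num)
    rw [← Complex.normSq_eq_norm_sq, ← Complex.normSq_eq_norm_sq] at h3
    simp [Complex.normSq_apply] at h3
    nlinarith
  by_contra! hcon
  obtain ⟨z1, hz1, hwz1⟩ := hcon
  have hz1' : ‖z1‖ < 1 := by simpa using hz1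
  have hsub : Metric.closedBall (0:ℂ) ‖z1‖ ⊆ Metric.ball 0 1 := Metric.closedBall_subset_ball hz1'
  have hcw : ContinuousOn w (Metric.closedBall 0 ‖z1‖) := hwd.continuousOn.mono hsub
  have hK : IsCompact (Metric.closedBall (0:ℂ) ‖z1‖ ∩ (fun z => ‖w z‖) ⁻¹' Set.Ici 1) := by
    apply (isCompact_closedBall (0:ℂ) ‖z1‖).of_isClosed_subset _ Set.inter_subset_left
    exact hcw.norm.preimage_isClosed_of_isClosed Metric.isClosed_closedBall isClosed_Ici
  obtain ⟨z0, ⟨hz0a, hz0b⟩, hmin⟩ := hK.exists_isMinOn ⟨z1, by simp, hwz1⟩ continuous_norm.continuousOn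
  have hz0B := hsub hz0a
  have hz0n : ‖z0‖ < 1 := by simpa using hz0B
  have hlt : ∀ z : ℂ, ‖z‖ < ‖z0‖ → ‖w z‖ < 1 := by
    intro z hz
    by_contra! h
    have : ‖z0‖ ≤ ‖z‖ := hmin ⟨by
      have : ‖z0‖ ≤ ‖z1‖ := by simpa using hz0a
      simp; linarith, h⟩
    linarith
  have hz0b : 1 ≤ ‖w z0‖ := hz0b
  have hz0 : z0 ≠ 0 := by
    rintro rfl
    rw [hw0] at hz0b; simp at hz0b; linarith
  have hr : 0 < ‖z0‖ := norm_pos_iff.2 hz0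
  have hle : ∀ z : ℂ, ‖z‖ ≤ ‖z0‖ → ‖w z‖ ≤ 1 := by
    intro z hz
    have hzB : z ∈ Metric.ball (0:ℂ) 1 := by simp; linarith
    have hcont : Filter.Tendsto (fun t : ℝ => ‖w (t * z)‖) (nhdsWithin 1 (Set.Iio 1)) (nhds ‖w z‖) := by
      have c1 : ContinuousAt w (((1:ℝ):ℂ) * z) := by
        simpa using (hwd' z hzB).continuousAt
      have c2 : ContinuousAt (fun t : ℝ => (t:ℂ) * z) 1 := by fun_prop
      have c3 : ContinuousAt (fun t : ℝ => w (t * z)) 1 := ContinuousAt.comp (f := fun t : ℝ => (t:ℂ) * z) c1 c2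
      have := c3.norm.tendsto
      simp only [Complex.ofReal_one, one_mul] at this
      exact this.mono_left nhdsWithin_le_nhds
    refine le_of_tendsto hcont ?_
    filter_upwards [Ioo_mem_nhdsLT (zero_lt_one (α := ℝ))] with t ht
    apply (hlt _ _).le
    simp only [norm_mul, Complex.norm_real, Real.norm_eq_abs, abs_of_pos ht.1]
    nlinarith [ht.1, ht.2, norm_nonneg z]
  have heq : ‖w z0‖ = 1 := le_antisymm (hle z0 le_rfl) hz0b
  -- rescaled function
  have hmul : ∀ c : ℂ, HasDerivAt (fun ζ : ℂ => z0 * ζ) z0 c := fun c => by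
    simpa using (hasDerivAt_id c).const_mul z0
  have hball : ∀ c : ℂ, ‖c‖ ≤ 1 → ‖z0 * c‖ ≤ ‖z0‖ := fun c hc => by
    rw [norm_mul]; nlinarith
  have hud : ∀ c : ℂ, ‖c‖ ≤ 1 → HasDerivAt (fun ζ => w (z0 * ζ))
      (deriv g (z0 * c) / (g (z0 * c))^2 * z0) c := fun c hc =>
    HasDerivAt.comp (h₂ := w) (h := fun ζ : ℂ => z0 * ζ) c (hwd' (z0 * c) (by have := hball c hc; simp only [mem_ball_zero_iff]; linarith)) (hmul c)
  have hd0 : deriv (fun ζ => w (z0 * ζ)) 0 = b * z0 := by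
    rw [(hud 0 (by simp)).deriv]; simp [hg0, hgb]
  have hd0n : ‖deriv (fun ζ => w (z0 * ζ)) 0‖ = b * ‖z0‖ := by
    rw [hd0]; simp [abs_of_nonneg hb0]
  obtain ⟨him, hre⟩ := aux_jack (fun ζ => w (z0 * ζ))
    (fun c hc => (hud c (by simpa using (mem_ball_zero_iff.1 hc).le)).differentiableAt.differentiableWithinAt)
    (fun c hc => hle _ (hball c hc)) (by simpa using hw0)
    (by rw [hd0n]; nlinarith) (by simpa using heq) _ (hud 1 (by simp))
  rw [hd0n] at hre
  simp only [mul_one] at him hre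
  have hs := hstar z0 hz0B hz0
  have hgz := hne z0 hz0B
  set D := deriv g z0 / (g z0)^2 * z0 with hD
  set W := w z0 with hW
  have hWW : conj W * W = 1 := by
    rw [mul_comm, Complex.mul_conj, Complex.normSq_eq_norm_sq, heq]; simp
  have hg' : g z0 = (1 - W)⁻¹ := by simp [hW, hw]
  have h1W : 1 - W ≠ 0 := by
    intro h; rw [hg', h] at hgz; simp at hgz
  set k := (D * conj W).re with hk
  have hkk : D * conj W = (k : ℂ) := by
    apply Complex.ext <;> simp [hk, him]
  have hDk : D = k * W := by
    rw [← hkk, mul_assoc, hWW, mul_one]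
  have hexp : z0 * deriv g z0 / g z0 = k * (W / (1 - W)) := by
    have : z0 * deriv g z0 / g z0 = D * g z0 := by
      rw [hD]; field_simp
    rw [this, hDk, hg']; ring
  have hhalf : (W / (1 - W)).re = -1/2 := by
    have hn : W.re^2 + W.im^2 = 1 := by
      have := congrArg Complex.re hWW
      simp at this; nlinarith
    have hd : Complex.normSq (1 - W) ≠ 0 := by simpa using h1W
    rw [Complex.div_re]
    field_simp
    simp [Complex.normSq_apply]
    nlinarith
  rw [hexp, Complex.re_ofReal_mul, hhalf] at hs
  have hb : 0 < 1 + b := by linarith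
  have h5 : k * (1 + b) < 2 := by
    have : k / 2 < 1 / (1 + b) := by linarith
    rw [lt_div_iff₀ hb] at this
    linarith
  have h6 : b * ‖z0‖ ≤ b := by nlinarith
  have h7 : 0 ≤ k := by
    by_contra! h
    have : 0 < 1 + b * ‖z0‖ := by positivity
    nlinarith
  nlinarith

/-- Corollary 3.4: for `f ∈ 𝒜_{p,b}` with `0 ≤ b ≤ 1`,
`Re(z f'/f) > p - 1/(1+b)` on the punctured disk implies `Re(f(z)/z^p) > 1/2` there. -/
theorem stmt_7 (p : ℕ) (hp : 1 ≤ p) (b : ℝ) (hb0 : 0 ≤ b) (hb1 : b ≤ 1)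
    (f g : ℂ → ℂ) (hg : DifferentiableOn ℂ g (Metric.ball 0 1)) (hg0 : g 0 = 1)
    (hgb : deriv g 0 = (b : ℂ))
    (hfg : ∀ z ∈ Metric.ball (0 : ℂ) 1, f z = z ^ p * g z)
    (hfne : ∀ z ∈ Metric.ball (0 : ℂ) 1, z ≠ 0 → f z ≠ 0)
    (hstar : ∀ z ∈ Metric.ball (0 : ℂ) 1, z ≠ 0 →
      (p : ℝ) - 1 / (1 + b) < (z * deriv f z / f z).re) :
    ∀ z ∈ Metric.ball (0 : ℂ) 1, z ≠ 0 → 1 / 2 < (f z / z ^ p).re := by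
  have hne : ∀ z ∈ Metric.ball (0 : ℂ) 1, g z ≠ 0 := by
    intro z hz
    by_cases h : z = 0
    · rw [h, hg0]; exact one_ne_zero
    · have := hfne z hz h
      rw [hfg z hz] at this
      exact right_ne_zero_of_mul this
  intro z hz hz0
  rw [hfg z hz, mul_div_cancel_left₀ _ (pow_ne_zero p hz0)]
  refine aux_main b hb0 hb1 g hg hg0 hgb hne ?_ z hz
  intro z hz hz0
  have h := hstar z hz hz0
  have hgz := hne z hz
  have hgd : HasDerivAt g (deriv g z) z :=
    (hg.differentiableAt (Metric.isOpen_ball.mem_nhds hz)).hasDerivAt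
  have hfd : HasDerivAt f (p * z ^ (p - 1) * g z + z ^ p * deriv g z) z := by
    refine ((hasDerivAt_pow p z).mul hgd).congr_of_eventuallyEq ?_
    filter_upwards [Metric.isOpen_ball.mem_nhds hz] with x hx using hfg x hx
  have e : z * deriv f z / f z = p + z * deriv g z / g z := by
    rw [hfd.deriv, hfg z hz]
    obtain ⟨q, rfl⟩ : ∃ q, p = q + 1 := ⟨p - 1, by omega⟩
    simp only [Nat.add_sub_cancel]
    field_simp
    ring
  rw [e, Complex.add_re, Complex.natCast_re] at h
  linarith
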